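/- arXiv:1603.03604 — 3 statements merged into one kernel-verified Lean document; each statement's English description precedes it below -/
import Mathlib

section
/- Let p be a prime and set n = 2p+1. Then 2 times the number of Fermat-admissible pairs for n and p equals p(p+1). (Equivalently, the rank of the Cartier operator on the Fermat curve F_{2p+1} is p(p+1)/2.) -/
/-- A pair `(i, j)` is *Fermat-admissible* for `n` and `p` if there exist integers
`h, k` with `0 ≤ h ≤ p - 1` and `0 ≤ k ≤ h` such that `n*(p-1-h) + i ≡ p-1 (mod p)`
and `n*k + j ≡ p-1 (mod p)`. -/
def FermatAdmissible (n p i j : ℕ) : Prop :=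
  ∃ h k : ℕ, h ≤ p - 1 ∧ k ≤ h ∧
    n * (p - 1 - h) + i ≡ p - 1 [MOD p] ∧ n * k + j ≡ p - 1 [MOD p]

/-- When `n ≡ 1 (mod p)`, admissibility only depends on the residues of `i` and `j` modulo `p`. -/
theorem fermatAdmissible_iff_of_modEq_one {n p : ℕ} (hp : 0 < p) (hn : n ≡ 1 [MOD p]) (i j : ℕ) :
    FermatAdmissible n p i j ↔ p - 1 ≤ i % p + j % p := by
  have hi := Nat.mod_lt i hp
  have hj := Nat.mod_lt j hp
  have red (a b : ℕ) : n * a + b ≡ a + b % p [MOD p] := by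
    simpa using (hn.mul_right a).add (Nat.mod_modEq b p).symm
  have aux {a b : ℕ} (ha : a ≤ p - 1) (hb : b < p) :
      a + b ≡ p - 1 [MOD p] ↔ a + b = p - 1 := by
    refine ⟨fun h => ?_, fun h => h ▸ rfl⟩
    rw [Nat.ModEq, Nat.mod_eq_of_lt (show p - 1 < p by omega)] at h
    have h1 := Nat.div_add_mod (a + b) p
    have h2 : (a + b) / p < 2 := Nat.div_lt_of_lt_mul (by omega)
    interval_cases (a + b) / p <;> omega
  have key (a b : ℕ) (ha : a ≤ p - 1) :
      n * a + b ≡ p - 1 [MOD p] ↔ a + b % p = p - 1 := by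
    rw [← aux ha (Nat.mod_lt b hp)]
    exact ⟨(red a b).symm.trans, (red a b).trans⟩
  constructor
  · rintro ⟨h, k, hh, hk, h1, h2⟩
    rw [key _ _ (by omega)] at h1 h2
    omega
  · intro h
    refine ⟨i % p, p - 1 - j % p, by omega, by omega, ?_, ?_⟩ <;>
      rw [key _ _ (by omega)] <;> omega

theorem two_mul_card_filter_pred_le_add (p : ℕ) :
    2 * ((Finset.range p ×ˢ Finset.range p).filter fun ij => p - 1 ≤ ij.1 + ij.2).card
      = p * (p + 1) := by
  have fiber : ∀ i ∈ Finset.range p,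
      (∑ j ∈ Finset.range p, if p - 1 ≤ i + j then 1 else 0) = i + 1 := by
    intro i hi
    rw [Finset.mem_range] at hi
    rw [← Finset.card_filter,
      show (Finset.range p).filter (fun j => p - 1 ≤ i + j) = Finset.Ico (p - 1 - i) p by
        ext j
        simp only [Finset.mem_filter, Finset.mem_range, Finset.mem_Ico]
        omega,
      Nat.card_Ico]
    omega
  rw [Finset.card_filter, Finset.sum_product, Finset.sum_congr rfl fiber]
  have h := Finset.sum_range_id_mul_two (p + 1)
  rw [Finset.sum_range_succ'] at h
  simp only [add_zero, Nat.add_sub_cancel] at h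
  linarith

/-- The rank of the Cartier operator on the Fermat curve `F_{2p+1}` is `p*(p+1)/2`. -/
theorem two_mul_card_fermatAdmissible_two_p_add_one
    (p n : ℕ) (hp : p.Prime) (hn : n = 2 * p + 1) :
    2 * {ij : ℕ × ℕ | (ij.1 : ℤ) + ij.2 ≤ (n : ℤ) - 3 ∧
          FermatAdmissible n p ij.1 ij.2}.ncard
      = p * (p + 1) := by
  have hn1 : n ≡ 1 [MOD p] := by simp [hn, Nat.ModEq]
  rw [← two_mul_card_filter_pred_le_add p, ← Set.ncard_coe_finset]
  congr 2
  ext ⟨i, j⟩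
  simp only [Set.mem_ofPred_eq, Finset.coe_filter, Finset.mem_product, Finset.mem_range,
    fermatAdmissible_iff_of_modEq_one hp.pos hn1]
  constructor
  · rintro ⟨h1, h2⟩
    have hi := Nat.mod_add_div i p
    have hj := Nat.mod_add_div j p
    have small {q : ℕ} (hq : p * q < p) : q = 0 := by
      by_contra h
      exact absurd (Nat.le_mul_of_pos_right p (Nat.pos_of_ne_zero h)) (by omega)
    have hqi := small (q := i / p) (by omega)
    have hqj := small (q := j / p) (by omega)
    rw [Nat.div_eq_zero_iff] at hqi hqj
    have := hp.pos
    have hip : i < p := by omega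
    have hjp : j < p := by omega
    rw [Nat.mod_eq_of_lt hip, Nat.mod_eq_of_lt hjp] at h2
    exact ⟨⟨hip, hjp⟩, h2⟩
  · rintro ⟨⟨h1, h2⟩, h3⟩
    rw [Nat.mod_eq_of_lt h1, Nat.mod_eq_of_lt h2]
    omega
end

section
/- Let p be a prime, let s ≥ 4 be an integer, and set n = sp−1. Then, as an identity of integers, 4 times the number of Fermat-admissible pairs for n and p equals 12(p−1)² + p(p+1)s² + p(p−11)s − 12p(p−2). (Equivalently, the rank of the Cartier operator on F_{sp−1} is 3(p−1)² + (p/4)[(p+1)s² + (p−11)s − 12(p−2)].) -/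
theorem fermatAdmissible_iff {p s : ℕ} (hp : 0 < p) (hs : 0 < s) (i j : ℕ) :
    FermatAdmissible (s * p - 1) p i j ↔ (i + 1) % p + (j + 1) % p < p := by
  have hn : ((s * p - 1 : ℕ) : ZMod p) = -1 := by
    rw [Nat.cast_pred (Nat.mul_pos hs hp)]; simp
  have hp1 : ((p - 1 : ℕ) : ZMod p) = -1 := by
    rw [Nat.cast_pred hp]; simp
  have key : ∀ h k : ℕ, h ≤ p - 1 →
      (((s * p - 1) * (p - 1 - h) + i ≡ p - 1 [MOD p] ∧ (s * p - 1) * k + j ≡ p - 1 [MOD p]) ↔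
        p ∣ h + (i + 1) + 1 ∧ j + 1 ≡ k [MOD p]) := by
    intro h k hh
    simp only [← ZMod.natCast_eq_natCast_iff, ← ZMod.natCast_eq_zero_iff]
    push_cast [Nat.cast_sub hh]
    rw [hn, hp1]
    constructor
    · rintro ⟨h1, h2⟩
      exact ⟨by linear_combination h1, by linear_combination h2⟩
    · rintro ⟨h1, h2⟩
      exact ⟨by linear_combination h1, by linear_combination h2⟩
  have hi := Nat.mod_lt (i + 1) hp
  have hj := Nat.mod_lt (j + 1) hp
  have hdi := Nat.div_add_mod (i + 1) p
  constructor
  · rintro ⟨h, k, hh, hk, hhk⟩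
    obtain ⟨h1, h2⟩ := (key h k hh).1 hhk
    have h3 : (j + 1) % p = k := by rw [h2, Nat.mod_eq_of_lt (by omega)]
    have h4 : p ∣ h + (i + 1) % p + 1 := by
      refine (Nat.dvd_add_right (Dvd.intro ((i + 1) / p) rfl)).1 ?_
      convert h1 using 1
      omega
    obtain ⟨c, hc⟩ := h4
    have hc2 : c < 2 := by
      by_contra! hc2
      have := Nat.mul_le_mul_left p hc2
      omega
    interval_cases c <;> omega
  · intro hlt
    refine ⟨p - 1 - (i + 1) % p, (j + 1) % p, by omega, by omega, (key _ _ (by omega)).2 ⟨?_, ?_⟩⟩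
    · refine ⟨(i + 1) / p + 1, ?_⟩
      rw [mul_add]
      omega
    · exact (Nat.mod_modEq _ _).symm

/-- The pairs of natural numbers `(x, y)` with `x + y < m`. -/
def pairsSumLT (m : ℕ) : Finset (ℕ × ℕ) :=
  (Finset.range m ×ˢ Finset.range m).filter fun x => x.1 + x.2 < m

theorem mem_pairsSumLT {m : ℕ} {x : ℕ × ℕ} : x ∈ pairsSumLT m ↔ x.1 + x.2 < m := by
  simp only [pairsSumLT, Finset.mem_filter, Finset.mem_product, Finset.mem_range]
  omega

theorem two_mul_card_pairsSumLT (m : ℕ) : 2 * (pairsSumLT m).card = m * (m + 1) := by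
  induction m with
  | zero => simp [pairsSumLT]
  | succ m ih =>
    have h : pairsSumLT (m + 1) = pairsSumLT m ∪ Finset.HasAntidiagonal.antidiagonal m := by
      ext x
      simp only [Finset.mem_union, mem_pairsSumLT, Finset.HasAntidiagonal.mem_antidiagonal]
      omega
    rw [h, Finset.card_union_of_disjoint, Finset.Nat.card_antidiagonal, mul_add, ih]
    · ring
    · refine Finset.disjoint_left.2 fun x hx hx' => ?_
      rw [mem_pairsSumLT] at hx
      rw [Finset.HasAntidiagonal.mem_antidiagonal] at hx'
      omega

/-- The pairs `(u, v)` with `u / p + v / p < s` whose last base-`p` digits add without carry. -/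
def noCarryPairs (s p : ℕ) : Finset (ℕ × ℕ) :=
  (pairsSumLT (s * p)).filter fun x => x.1 % p + x.2 % p < p

theorem div_add_div_lt {s p u v : ℕ} (h : u + v < s * p) : u / p + v / p < s := by
  have hu := Nat.div_add_mod u p
  have hv := Nat.div_add_mod v p
  by_contra! hle
  have := Nat.mul_le_mul_left p hle
  rw [mul_add, mul_comm p s] at this
  omega

theorem card_noCarryPairs {s p : ℕ} (hp : 0 < p) :
    (noCarryPairs s p).card = (pairsSumLT s).card * (pairsSumLT p).card := by
  rw [← Finset.card_product]
  refine Finset.card_nbij' (fun x => ((x.1 / p, x.2 / p), (x.1 % p, x.2 % p)))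
    (fun y => (p * y.1.1 + y.2.1, p * y.1.2 + y.2.2)) ?_ ?_ ?_ ?_
  · intro x hx
    simp only [noCarryPairs, Finset.coe_filter, Set.mem_ofPred_eq, mem_pairsSumLT] at hx
    simp only [Finset.mem_coe, Finset.mem_product, mem_pairsSumLT]
    exact ⟨div_add_div_lt hx.1, hx.2⟩
  · rintro ⟨⟨a, b⟩, α, β⟩ hy
    simp only [Finset.mem_coe, Finset.mem_product, mem_pairsSumLT] at hy
    simp only [noCarryPairs, Finset.coe_filter, Set.mem_ofPred_eq, mem_pairsSumLT]
    obtain ⟨h1, h2⟩ := hy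
    rw [Nat.mul_add_mod, Nat.mul_add_mod, Nat.mod_eq_of_lt (by omega), Nat.mod_eq_of_lt (by omega)]
    have := Nat.mul_le_mul_left p (Nat.succ_le_of_lt h1)
    rw [Nat.mul_succ, mul_add, mul_comm p s] at this
    omega
  · intro x _
    simp [Nat.div_add_mod]
  · rintro ⟨⟨a, b⟩, α, β⟩ hy
    simp only [Finset.mem_coe, Finset.mem_product, mem_pairsSumLT] at hy
    have hα : α < p := by omega
    have hβ : β < p := by omega
    simp [Nat.mul_add_div hp, Nat.mod_eq_of_lt, Nat.div_eq_of_lt, hα, hβ]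

theorem mod_add_mod_lt_of_add_eq {s p u v : ℕ} (hp : 0 < p) (h : u + v + 1 = s * p) :
    u % p + v % p < p := by
  have hu := Nat.mod_lt u hp
  have hv := Nat.mod_lt v hp
  have h1 : p ∣ u % p + v % p + 1 := by
    refine (Nat.dvd_add_right (Dvd.intro (u / p + v / p) rfl)).1 ⟨s, ?_⟩
    rw [mul_comm p s, ← h, mul_add]
    have := Nat.div_add_mod u p
    have := Nat.div_add_mod v p
    omega
  obtain ⟨c, hc⟩ := h1
  have hc2 : c < 2 := by
    by_contra! hc2
    have := Nat.mul_le_mul_left p hc2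
    omega
  interval_cases c <;> omega

/-- The pairs in `noCarryPairs s p` on none of the three sides `u = 0`, `v = 0`,
`u + v = s * p - 1`. -/
def interiorNoCarryPairs (s p : ℕ) : Finset (ℕ × ℕ) :=
  (noCarryPairs s p).filter fun x => 0 < x.1 ∧ 0 < x.2 ∧ x.1 + x.2 + 1 < s * p

theorem card_interiorNoCarryPairs {s p : ℕ} (hp : 0 < p) (hN : 2 ≤ s * p) :
    (interiorNoCarryPairs s p).card + 3 * (s * p - 1) = (noCarryPairs s p).card := by
  set N := s * p with hNdef
  rw [← Finset.card_filter_add_card_filter_not (s := noCarryPairs s p)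
    (fun x => 0 < x.1 ∧ 0 < x.2 ∧ x.1 + x.2 + 1 < N), interiorNoCarryPairs, ← hNdef,
    Nat.add_left_cancel_iff]
  have hsides : (noCarryPairs s p).filter (fun x => ¬(0 < x.1 ∧ 0 < x.2 ∧ x.1 + x.2 + 1 < N)) =
      (Finset.range (N - 1)).image (fun t => (0, t)) ∪
      ((Finset.range (N - 1)).image (fun t => (t + 1, 0)) ∪
      (Finset.range (N - 1)).image (fun t => (t, N - 1 - t))) := by
    ext ⟨u, v⟩
    simp only [noCarryPairs, Finset.mem_filter, mem_pairsSumLT, Finset.mem_union,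
      Finset.mem_image, Finset.mem_range, Prod.mk.injEq, ← hNdef]
    constructor
    · rintro ⟨⟨h1, -⟩, h2⟩
      by_cases hv : v = 0
      · by_cases hu : u = 0
        · exact Or.inl ⟨0, by omega⟩
        · exact Or.inr (Or.inl ⟨u - 1, by omega⟩)
      · by_cases h : u + v + 1 = N
        · exact Or.inr (Or.inr ⟨u, by omega⟩)
        · exact Or.inl ⟨v, by omega⟩
    · rintro (⟨t, ht, rfl, rfl⟩ | ⟨t, ht, rfl, rfl⟩ | ⟨t, ht, rfl, rfl⟩)
      · have := Nat.mod_lt t hp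
        simp only [Nat.zero_mod]
        omega
      · have := Nat.mod_lt (t + 1) hp
        simp only [Nat.zero_mod]
        omega
      · refine ⟨⟨by omega, mod_add_mod_lt_of_add_eq (s := s) hp (by omega)⟩, by omega⟩
  rw [hsides, Finset.card_union_of_disjoint, Finset.card_union_of_disjoint,
    Finset.card_image_of_injective, Finset.card_image_of_injective, Finset.card_image_of_injective,
    Finset.card_range]
  · ring
  · intro a b h
    simp only [Prod.mk.injEq] at h
    omega
  · intro a b h
    simp only [Prod.mk.injEq] at h
    omega
  · intro a b h
    simp only [Prod.mk.injEq] at h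
    omega
  · rw [Finset.disjoint_left]
    simp only [Finset.mem_image, Finset.mem_range]
    rintro _ ⟨t, ht, rfl⟩ ⟨t', ht', h⟩
    simp only [Prod.mk.injEq] at h
    omega
  · rw [Finset.disjoint_left]
    simp only [Finset.mem_union, Finset.mem_image, Finset.mem_range]
    rintro _ ⟨t, ht, rfl⟩ (⟨t', ht', h⟩ | ⟨t', ht', h⟩) <;>
    · simp only [Prod.mk.injEq] at h
      omega

theorem ncard_fermatAdmissible {p s : ℕ} (hp : 0 < p) (hs : 0 < s) :
    {ij : ℕ × ℕ | (ij.1 : ℤ) + ij.2 ≤ ((s * p - 1 : ℕ) : ℤ) - 3 ∧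
      FermatAdmissible (s * p - 1) p ij.1 ij.2}.ncard = (interiorNoCarryPairs s p).card := by
  have hinj : Function.Injective fun x : ℕ × ℕ => (x.1 + 1, x.2 + 1) := by
    rintro ⟨a, b⟩ ⟨c, d⟩ h
    simpa using h
  rw [← Set.ncard_image_of_injective _ hinj, ← Set.ncard_coe_finset]
  congr 1
  ext ⟨u, v⟩
  simp only [fermatAdmissible_iff hp hs, Set.mem_image, Set.mem_ofPred_eq, Prod.exists,
    Prod.mk.injEq, interiorNoCarryPairs, noCarryPairs, Finset.mem_coe, Finset.mem_filter,
    mem_pairsSumLT]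
  constructor
  · rintro ⟨i, j, ⟨h1, h2⟩, rfl, rfl⟩
    exact ⟨⟨by omega, h2⟩, by omega⟩
  · rintro ⟨⟨h1, h2⟩, hu, hv, h3⟩
    refine ⟨u - 1, v - 1, ⟨by omega, ?_⟩, by omega, by omega⟩
    rwa [Nat.sub_add_cancel hu, Nat.sub_add_cancel hv]

/-- For `s ≥ 4`, the rank of the Cartier operator on the Fermat curve `F_{sp-1}` is
`3*(p-1)^2 + (p/4)*((p+1)*s^2 + (p-11)*s - 12*(p-2))`, as an identity in `ℤ`. -/
theorem four_mul_card_fermatAdmissible_sp_sub_one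
    (p s n : ℕ) (hp : p.Prime) (hs : 4 ≤ s) (hn : n = s * p - 1) :
    4 * ({ij : ℕ × ℕ | (ij.1 : ℤ) + ij.2 ≤ (n : ℤ) - 3 ∧
          FermatAdmissible n p ij.1 ij.2}.ncard : ℤ)
      = 12 * ((p : ℤ) - 1) ^ 2 + (p : ℤ) * ((p : ℤ) + 1) * (s : ℤ) ^ 2
          + (p : ℤ) * ((p : ℤ) - 11) * (s : ℤ) - 12 * (p : ℤ) * ((p : ℤ) - 2) := by
  subst hn
  have hN : 2 ≤ s * p := by nlinarith [hp.two_le]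
  have h1 := card_interiorNoCarryPairs hp.pos hN
  rw [card_noCarryPairs hp.pos] at h1
  have h2 := two_mul_card_pairsSumLT s
  have h3 := two_mul_card_pairsSumLT p
  rw [ncard_fermatAdmissible hp.pos (by omega)]
  zify [(by omega : 1 ≤ s * p)] at h1 h2 h3
  linear_combination 4 * h1 + 2 * ((pairsSumLT p).card : ℤ) * h2 + (s : ℤ) * (s + 1) * h3
end

section
/- Let p be a prime, let s ≥ 1 be an integer, and set n = sp+1. Then 4 times the number of pairs (i,j) of nonnegative integers with i+j ≤ n−2 that are not Hurwitz-admissible for n and p equals s(s−1)p(p−1). (Equivalently, the a-number of the Hurwitz curve H_{sp+1} is a(H_{sp+1}) = s(s−1)p(p−1)/4.) -/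
/-- A pair `(i, j)` is *Hurwitz-admissible* for `n` and `p` if there exist integers
`h, k` with `0 ≤ h ≤ p - 1` and `0 ≤ k ≤ h` such that `n*k - h + i ≡ 0 (mod p)`
and `n*(h-k) + k + j ≡ p-1 (mod p)`. -/
def HurwitzAdmissible (n p i j : ℕ) : Prop :=
  ∃ h k : ℕ, h ≤ p - 1 ∧ k ≤ h ∧
    ((n : ℤ) * k - h + i ≡ 0 [ZMOD (p : ℤ)]) ∧
    ((n : ℤ) * ((h : ℤ) - k) + k + j ≡ (p : ℤ) - 1 [ZMOD (p : ℤ)])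

theorem hurwitzAdmissible_sp_add_one_iff {p : ℕ} (hp : 0 < p) (s i j : ℕ) :
    HurwitzAdmissible (s * p + 1) p i j ↔ i % p + j % p < p := by
  have hi := Nat.mod_lt i hp
  have hj := Nat.mod_lt j hp
  have hi' : (i : ℤ) = p * (i / p : ℕ) + (i % p : ℕ) := by
    exact_mod_cast (Nat.div_add_mod i p).symm
  have hj' : (j : ℤ) = p * (j / p : ℕ) + (j % p : ℕ) := by
    exact_mod_cast (Nat.div_add_mod j p).symm
  constructor
  · rintro ⟨h, k, hh, hk, h1, h2⟩
    have e1 : i % p = h - k := by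
      have : i ≡ h - k [MOD p] := by
        rw [← Int.natCast_modEq_iff, Int.modEq_iff_dvd]
        obtain ⟨c, hc⟩ := Int.modEq_iff_dvd.1 h1
        refine ⟨s * k + c, ?_⟩
        push_cast [hk] at hc ⊢
        linear_combination hc
      rw [this, Nat.mod_eq_of_lt (by omega)]
    have e2 : j % p = p - 1 - h := by
      have : j ≡ p - 1 - h [MOD p] := by
        rw [← Int.natCast_modEq_iff, Int.modEq_iff_dvd]
        obtain ⟨c, hc⟩ := Int.modEq_iff_dvd.1 h2
        refine ⟨s * (h - k) + c, ?_⟩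
        push_cast [hh, Nat.one_le_iff_ne_zero.2 hp.ne'] at hc ⊢
        linear_combination hc
      rw [this, Nat.mod_eq_of_lt (by omega)]
    omega
  · intro hlt
    refine ⟨p - 1 - j % p, p - 1 - j % p - i % p, by omega, by omega, ?_, ?_⟩
    all_goals
      have c1 : ((p - 1 - j % p : ℕ) : ℤ) = p - 1 - (j % p : ℕ) := by omega
      have c2 : ((p - 1 - j % p - i % p : ℕ) : ℤ) = p - 1 - (j % p : ℕ) - (i % p : ℕ) := by omega
      rw [c1, c2, Int.modEq_iff_dvd]
    · refine ⟨-(s * (p - 1 - (j % p : ℕ) - (i % p : ℕ)) + (i / p : ℕ)), ?_⟩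
      push_cast at hi' hj' ⊢
      linear_combination -hi'
    · refine ⟨-(s * (i % p : ℕ) + (j / p : ℕ)), ?_⟩
      push_cast at hi' hj' ⊢
      linear_combination -hj'

theorem two_mul_card_filter_le_add (m : ℕ) :
    2 * ((Finset.range m ×ˢ Finset.range m).filter fun x => m ≤ x.1 + x.2).card
      = m * (m - 1) := by
  rw [mul_comm 2, ← Finset.sum_range_id_mul_two, Finset.card_filter, Finset.sum_product]
  congr 1
  refine Finset.sum_congr rfl fun c hc => ?_
  rw [← Finset.card_filter]
  have : (Finset.range m).filter (fun d => m ≤ c + d) = Finset.Ico (m - c) m := by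
    ext d
    simp only [Finset.mem_filter, Finset.mem_range, Finset.mem_Ico]
    omega
  rw [Finset.mem_range] at hc
  rw [this, Nat.card_Ico]
  omega

theorem two_mul_card_filter_add_two_le (m : ℕ) :
    2 * ((Finset.range m ×ˢ Finset.range m).filter fun x => x.1 + x.2 + 2 ≤ m).card
      = m * (m - 1) := by
  rw [← two_mul_card_filter_le_add]
  congr 1
  refine Finset.card_nbij' (fun x => (m - 1 - x.1, m - 1 - x.2))
    (fun x => (m - 1 - x.1, m - 1 - x.2)) ?_ ?_ ?_ ?_ <;>
  · rintro ⟨a, b⟩ h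
    simp only [Finset.coe_filter, Finset.mem_product, Finset.mem_range, Set.mem_ofPred_eq,
      Prod.mk.injEq] at h ⊢
    omega

theorem add_le_mul_sub_one_iff {p s i j : ℕ} (hp : 0 < p) (hs : 1 ≤ s)
    (h : p ≤ i % p + j % p) : i + j ≤ s * p - 1 ↔ i / p + j / p + 2 ≤ s := by
  have hi := Nat.mod_lt i hp
  have hj := Nat.mod_lt j hp
  have hi' := Nat.div_add_mod i p
  have hj' := Nat.div_add_mod j p
  have hsp : 0 < s * p := Nat.mul_pos hs hp
  constructor
  · intro hle
    have : (i / p + j / p + 1) * p < s * p := by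
      have : (i / p + j / p + 1) * p = p * (i / p) + p * (j / p) + p := by ring
      omega
    have := lt_of_mul_lt_mul_right this (Nat.zero_le p)
    omega
  · intro hle
    have h1 := Nat.mul_le_mul_right p hle
    have : (i / p + j / p + 2) * p = p * (i / p) + p * (j / p) + p + p := by ring
    omega

/-- The `a`-number of the Hurwitz curve `H_{sp+1}` is `s*(s-1)*p*(p-1)/4`. -/
theorem four_mul_card_not_hurwitzAdmissible_sp_add_one
    (p s n : ℕ) (hp : p.Prime) (hs : 1 ≤ s) (hn : n = s * p + 1) :
    4 * {ij : ℕ × ℕ | ij.1 + ij.2 ≤ n - 2 ∧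
          ¬ HurwitzAdmissible n p ij.1 ij.2}.ncard
      = s * (s - 1) * p * (p - 1) := by
  subst hn
  have hp0 := hp.pos
  set A := (Finset.range s ×ˢ Finset.range s).filter fun x => x.1 + x.2 + 2 ≤ s with hA
  set B := (Finset.range p ×ˢ Finset.range p).filter fun x => p ≤ x.1 + x.2 with hB
  have key : {ij : ℕ × ℕ | ij.1 + ij.2 ≤ s * p + 1 - 2 ∧
      ¬ HurwitzAdmissible (s * p + 1) p ij.1 ij.2}.ncard = (A ×ˢ B).card := by
    rw [← Set.ncard_coe_finset]
    refine Set.ncard_congr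
      (fun ij _ => ((ij.1 / p, ij.2 / p), (ij.1 % p, ij.2 % p))) ?_ ?_ ?_
    · rintro ⟨i, j⟩ ⟨h1, h2⟩
      rw [hurwitzAdmissible_sp_add_one_iff hp0, not_lt] at h2
      have h3 := (add_le_mul_sub_one_iff hp0 hs h2).1 h1
      have hi := Nat.mod_lt i hp0
      have hj := Nat.mod_lt j hp0
      simp only [hA, hB, Finset.mem_coe, Finset.mem_product, Finset.mem_filter, Finset.mem_range]
      dsimp only at h2 h3
      generalize i / p = a, j / p = b at h3 ⊢
      omega
    · rintro ⟨i, j⟩ ⟨i', j'⟩ _ _ h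
      simp only [Prod.mk.injEq] at h ⊢
      obtain ⟨⟨h1, h2⟩, h3, h4⟩ := h
      rw [← Nat.div_add_mod i p, ← Nat.div_add_mod j p, h1, h2, h3, h4]
      exact ⟨Nat.div_add_mod i' p, Nat.div_add_mod j' p⟩
    · rintro ⟨⟨a, b⟩, ⟨c, d⟩⟩ h
      simp only [hA, hB, Finset.mem_coe, Finset.mem_product, Finset.mem_filter,
        Finset.mem_range] at h
      obtain ⟨⟨-, hab⟩, ⟨hc, hd⟩, hcd⟩ := h
      have div_eq {x y : ℕ} (hy : y < p) : (p * x + y) / p = x := by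
        rw [Nat.mul_add_div hp0, Nat.div_eq_of_lt hy, add_zero]
      have mod_eq {x y : ℕ} (hy : y < p) : (p * x + y) % p = y := by
        rw [Nat.mul_add_mod, Nat.mod_eq_of_lt hy]
      refine ⟨(p * a + c, p * b + d), ⟨?_, ?_⟩, ?_⟩
      · refine (add_le_mul_sub_one_iff (i := p * a + c) (j := p * b + d) hp0 hs ?_).2 ?_
        · simpa only [mod_eq hc, mod_eq hd]
        · simpa only [div_eq hc, div_eq hd]
      · rw [hurwitzAdmissible_sp_add_one_iff hp0, not_lt]
        simpa only [mod_eq hc, mod_eq hd]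
      · simp only [div_eq hc, div_eq hd, mod_eq hc, mod_eq hd]
  have h1 : 2 * A.card = s * (s - 1) := two_mul_card_filter_add_two_le s
  have h2 : 2 * B.card = p * (p - 1) := two_mul_card_filter_le_add p
  rw [key, Finset.card_product, mul_assoc (s * (s - 1)), ← h1, ← h2]
  ring
end
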